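/- Let m be an odd positive integer and let δ be a real number with 0 < δ < 1/3 and H(3δ/2) < 1/2. Let c(X) ∈ J_m and let d_c be the dimension over Z/2 of the ideal of R_m generated by c(X). Then the number of pairs (a(X), b(X)) ∈ J_m × J_m such that 1 ≤ wt_H(c(X)a(X)) + 2·wt_H(c(X)b(X)) ≤ 3mδ is at most 2^{2(m−1)} · 2^{−2 d_c + 2 d_c H(3δ/2)}. -/

import Mathlib

open Polynomial

noncomputable section

/-- The polynomial `X^m - 1` over `Z/2`. -/
def fm (m : ℕ) : Polynomial (ZMod 2) := X ^ m - 1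

/-- The polynomial `X^m - 1` over `Z/4`. -/
def fm4 (m : ℕ) : Polynomial (ZMod 4) := X ^ m - 1

/-- `R_m = (Z/2)[X]/⟨X^m - 1⟩`. -/
abbrev R2 (m : ℕ) : Type := Polynomial (ZMod 2) ⧸ Ideal.span {fm m}

/-- `R'_m = (Z/4)[X]/⟨X^m - 1⟩`. -/
abbrev R4 (m : ℕ) : Type := Polynomial (ZMod 4) ⧸ Ideal.span {fm4 m}

def mk2 (m : ℕ) : Polynomial (ZMod 2) →+* R2 m := Ideal.Quotient.mk _

def mk4 (m : ℕ) : Polynomial (ZMod 4) →+* R4 m := Ideal.Quotient.mk _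

/-- The canonical representative (of degree `< m`) of an element of `R2 m`. -/
def rep2 (m : ℕ) (r : R2 m) : Polynomial (ZMod 2) :=
  (Function.surjInv (Ideal.Quotient.mk_surjective (I := Ideal.span {fm m})) r) %ₘ fm m

/-- The canonical representative (of degree `< m`) of an element of `R4 m`. -/
def rep4 (m : ℕ) (r : R4 m) : Polynomial (ZMod 4) :=
  (Function.surjInv (Ideal.Quotient.mk_surjective (I := Ideal.span {fm4 m})) r) %ₘ fm4 m

/-- Coefficientwise doubling map `(Z/2)[X] → (Z/4)[X]`, `a ↦ 2a` on each coefficient. -/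
def polyDbl (p : Polynomial (ZMod 2)) : Polynomial (ZMod 4) :=
  ∑ i ∈ p.support, Polynomial.C (2 * ((p.coeff i).val : ZMod 4)) * X ^ i

/-- The additive embedding `R_m → R'_m`, `f ↦ 2f`. -/
def iota (m : ℕ) (r : R2 m) : R4 m := mk4 m (polyDbl (rep2 m r))

/-- Hamming weight of an element of `R_m` (of its coefficient vector). -/
def wt2 (m : ℕ) (r : R2 m) : ℕ := (rep2 m r).support.card

/-- Lee weight of an element of `Z/4`. -/
def lee (x : ZMod 4) : ℕ := min x.val (4 - x.val)

/-- Lee weight of an element of `R'_m` (of its coefficient vector). -/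
def wtLee (m : ℕ) (r : R4 m) : ℕ := ∑ i ∈ (rep4 m r).support, lee ((rep4 m r).coeff i)

/-- The augmentation ideal `J_m = ⟨X - 1⟩` of `R_m`. -/
def Jm (m : ℕ) : Ideal (R2 m) := Ideal.span {mk2 m (X - 1)}

/-- The `Z2Z4`-additive cyclic code `C_{a,b} = {(f·a, 2(f·b)) : f ∈ R_m}`. -/
def Cab (m : ℕ) (a b : R2 m) : Set (R2 m × R4 m) :=
  {w | ∃ f : R2 m, w = (f * a, iota m (f * b))}

/-- Dimension of `C_{a,b}` as a vector space over `Z/2`, i.e. `log₂ |C_{a,b}|`. -/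
def dimCab (m : ℕ) (a b : R2 m) : ℕ := Nat.log 2 (Nat.card (Cab m a b))

/-- `(X^m - 1)/(X - 1) = X^{m-1} + ⋯ + X + 1` over `Z/2`. -/
def geomPoly (m : ℕ) : Polynomial (ZMod 2) := ∑ i ∈ Finset.range m, X ^ i

/-- `ℓ_m`: minimal degree of the irreducible factors of `(X^m-1)/(X-1)` in `(Z/2)[X]`. -/
def ell (m : ℕ) : ℕ :=
  sInf {d | ∃ p : Polynomial (ZMod 2), Irreducible p ∧ p ∣ geomPoly m ∧ p.natDegree = d}

/-- The binary entropy function `H(x) = -x·log₂x - (1-x)·log₂(1-x)`. -/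
def Hent (x : ℝ) : ℝ := -(x * Real.logb 2 x) - (1 - x) * Real.logb 2 (1 - x)


theorem info_set {C ι : Type} [AddCommGroup C] [Module (ZMod 2) C] [Module.Finite (ZMod 2) C]
    [Finite ι] (φ : ι → Module.Dual (ZMod 2) C) (hφ : ∀ f, (∀ i, φ i f = 0) → f = 0) :
    ∃ (κ : Type) (_ : Fintype κ) (a : κ → ι), Fintype.card κ = Module.finrank (ZMod 2) C ∧
      ∀ f, (∀ k, φ (a k) f = 0) → f = 0 := by
  obtain ⟨κ, a, ha, hspan, hli⟩ := exists_linearIndependent' (ZMod 2) φ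
  have : Finite κ := Finite.of_injective a ha
  let F : Fintype κ := Fintype.ofFinite κ
  have hinj : ∀ f, (∀ k, φ (a k) f = 0) → f = 0 := by
    intro f hf
    apply hφ
    intro i
    have hi : φ i ∈ Submodule.span (ZMod 2) (Set.range (φ ∘ a)) := by
      rw [hspan]; exact Submodule.subset_span ⟨i, rfl⟩
    have hle : Submodule.span (ZMod 2) (Set.range (φ ∘ a)) ≤
        LinearMap.ker (Module.Dual.eval (ZMod 2) C f) := by
      rw [Submodule.span_le]
      rintro _ ⟨k, rfl⟩
      exact hf k
    exact hle hi
  refine ⟨κ, F, a, le_antisymm ?_ ?_, hinj⟩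
  · rw [← Subspace.dual_finrank_eq (K := ZMod 2) (V := C)]
    exact hli.fintype_card_le_finrank
  · have := LinearMap.finrank_le_finrank_of_injective
      (f := (LinearMap.pi (fun k => φ (a k)) : C →ₗ[ZMod 2] (κ → ZMod 2))) (by
        rw [← LinearMap.ker_eq_bot, LinearMap.ker_eq_bot']
        intro f hf
        exact hinj f (fun k => congrFun hf k))
    simpa using this

theorem fm_monic (m : ℕ) (h : 0 < m) : (fm m).Monic := by
  unfold fm; exact monic_X_pow_sub_C 1 h.ne'

theorem fm_natDegree (m : ℕ) : (fm m).natDegree = m := by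
  unfold fm; exact natDegree_X_pow_sub_C (r := (1 : ZMod 2))

theorem rep2_eq (m : ℕ) (h : 0 < m) (r : R2 m) :
    rep2 m r = AdjoinRoot.modByMonicHom (fm_monic m h) r := by
  unfold rep2
  rw [← AdjoinRoot.modByMonicHom_mk (fm_monic m h)]
  congr 1
  exact Function.surjInv_eq (Ideal.Quotient.mk_surjective (I := Ideal.span {fm m})) r

theorem mk2_rep2 (m : ℕ) (h : 0 < m) (r : R2 m) : mk2 m (rep2 m r) = r := by
  rw [rep2_eq m h]
  exact AdjoinRoot.mk_leftInverse (fm_monic m h) r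

theorem rep2_mk (m : ℕ) (h : 0 < m) (p : (ZMod 2)[X]) : rep2 m (mk2 m p) = p %ₘ fm m := by
  rw [rep2_eq m h]
  exact AdjoinRoot.modByMonicHom_mk (fm_monic m h) p

theorem rep2_degree (m : ℕ) (h : 0 < m) (r : R2 m) : (rep2 m r).degree < m := by
  unfold rep2
  have := degree_modByMonic_lt (Function.surjInv (Ideal.Quotient.mk_surjective (I := Ideal.span {fm m})) r) (fm_monic m h)
  rwa [degree_eq_natDegree (fm_monic m h).ne_zero, fm_natDegree] at this

theorem finite_R2 (m : ℕ) (h : 0 < m) : Module.Finite (ZMod 2) (R2 m) :=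
  (fm_monic m h).finite_adjoinRoot

theorem finrank_R2 (m : ℕ) (h : 0 < m) : Module.finrank (ZMod 2) (R2 m) = m := by
  have := (AdjoinRoot.powerBasis' (fm_monic m h)).finrank
  rw [AdjoinRoot.powerBasis'_dim, fm_natDegree] at this
  exact this

/-- i-th cyclic coefficient -/
def coefL (m : ℕ) (h : 0 < m) (i : ZMod m) : R2 m →ₗ[ZMod 2] ZMod 2 :=
  (Polynomial.lcoeff (ZMod 2) i.val).comp (AdjoinRoot.modByMonicHom (fm_monic m h))

theorem coefL_apply (m : ℕ) (h : 0 < m) (i : ZMod m) (r : R2 m) :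
    coefL m h i r = (rep2 m r).coeff i.val := by
  rw [rep2_eq m h]; rfl

theorem coefL_sep (m : ℕ) (h : 0 < m) (r : R2 m) (hr : ∀ i, coefL m h i r = 0) : r = 0 := by
  have : NeZero m := ⟨h.ne'⟩
  rw [← mk2_rep2 m h r]
  have : rep2 m r = 0 := by
    ext k
    by_cases hk : k < m
    · have := hr (k : ZMod m)
      rw [coefL_apply, ZMod.val_cast_of_lt hk] at this
      simpa using this
    · rw [coeff_zero]
      apply coeff_eq_zero_of_degree_lt
      exact (rep2_degree m h r).trans_le (by exact_mod_cast not_lt.1 hk)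
  rw [this, map_zero]

theorem wt2_eq (m : ℕ) [NeZero m] (h : 0 < m) (r : R2 m) :
    wt2 m r = (Finset.univ.filter (fun i : ZMod m => coefL m h i r ≠ 0)).card := by
  unfold wt2
  symm
  refine Finset.card_bij (fun i _ => i.val) ?_ ?_ ?_
  · intro i hi
    simpa [coefL_apply] using hi
  · intro i _ j _ hij
    exact ZMod.val_injective m hij
  · intro k hk
    have hk' := mem_support_iff.1 hk
    have hkm : k < m := by
      have := (le_degree_of_ne_zero hk').trans_lt (rep2_degree m h r)
      exact_mod_cast this
    refine ⟨(k : ZMod m), ?_, ZMod.val_cast_of_lt hkm⟩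
    simpa [coefL_apply, ZMod.val_cast_of_lt hkm] using hk'

theorem coefL_shift (m : ℕ) (h : 0 < m) (i : ZMod m) (r : R2 m) :
    coefL m h i (mk2 m X * r) = coefL m h (i - 1) r := by
  have hne : NeZero m := ⟨h.ne'⟩
  rw [coefL_apply, coefL_apply]
  set q := rep2 m r with hq
  have hdeg := rep2_degree m h r
  have hmod : rep2 m (mk2 m X * r) = X * q - C (q.coeff (m-1)) * fm m := by
    rw [← mk2_rep2 m h r, ← map_mul, rep2_mk m h, ← hq]
    have := (div_modByMonic_unique (f := X * q) (C (q.coeff (m-1))) (X * q - C (q.coeff (m-1)) * fm m) (fm_monic m h) ⟨by rw [mul_comm (fm m)]; exact sub_add_cancel _ _, ?_⟩).2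
    · exact this
    · rw [degree_eq_natDegree (fm_monic m h).ne_zero, fm_natDegree, degree_lt_iff_coeff_zero]
      intro k hk
      obtain ⟨n, rfl⟩ : ∃ n, k = n + 1 := ⟨k - 1, by omega⟩
      rw [coeff_sub, coeff_X_mul, coeff_C_mul]
      unfold fm
      rw [coeff_sub, coeff_X_pow, coeff_one]
      by_cases hnm : n + 1 = m
      · simp [← hnm]
      · have : q.coeff n = 0 := coeff_eq_zero_of_degree_lt
          (hdeg.trans_le (by exact_mod_cast (by omega : m ≤ n)))
        simp [this, hnm]
  rw [hmod]
  have hval : i.val < m := ZMod.val_lt i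
  rcases hiv : i.val with _ | n
  · have hi0 : i = 0 := (ZMod.val_eq_zero i).1 hiv
    subst hi0
    have : ((0:ZMod m) - 1).val = m - 1 := by
      obtain ⟨n, rfl⟩ : ∃ n, m = n + 1 := ⟨m - 1, by omega⟩
      rw [zero_sub, ZMod.val_neg_one]; simp
    rw [this]
    unfold fm
    simp [coeff_X_pow, coeff_one, h.ne, mul_coeff_zero]
  · have hi : i = ((n + 1 : ℕ) : ZMod m) := by rw [← hiv]; simp
    have : (i - 1).val = n := by
      rw [hi]; push_cast; rw [add_sub_cancel_right, ZMod.val_cast_of_lt (by omega)]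
    rw [this, coeff_sub, coeff_X_mul, coeff_C_mul]
    unfold fm
    rw [coeff_sub, coeff_X_pow, coeff_one]
    have : n + 1 ≠ m := by omega
    simp [this]

theorem coefL_shift_pow (m : ℕ) (h : 0 < m) (k : ℕ) (i : ZMod m) (r : R2 m) :
    coefL m h i (mk2 m X ^ k * r) = coefL m h (i - k) r := by
  induction k generalizing i with
  | zero => simp
  | succ k ih =>
    rw [pow_succ', mul_assoc, coefL_shift, ih]
    congr 1; push_cast; ring

theorem X_pow_m (m : ℕ) : mk2 m X ^ m = 1 := by
  rw [← map_pow, ← sub_eq_zero, ← map_one (mk2 m), ← map_sub]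
  exact Ideal.Quotient.eq_zero_iff_mem.2 (Ideal.mem_span_singleton_self _)

theorem Jm_ne_top (m : ℕ) : Jm m ≠ ⊤ := by
  intro h
  have h1 : (1 : R2 m) ∈ Jm m := by rw [h]; trivial
  unfold Jm at h1
  obtain ⟨s, hs⟩ := Ideal.mem_span_singleton.1 h1
  obtain ⟨p, rfl⟩ := Ideal.Quotient.mk_surjective s
  have h2 : mk2 m (1 - (X - 1) * p) = 0 := by
    rw [map_sub, map_one, map_mul, hs]; exact sub_self _
  obtain ⟨q, hq⟩ := Ideal.mem_span_singleton.1 (Ideal.Quotient.eq_zero_iff_mem.1 h2)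
  have := congrArg (eval 1) hq
  simp [fm] at this

theorem mem_Jm_factor (m : ℕ) (hm : Odd m) (c : R2 m) (hc : c ∈ Jm m) :
    ∃ e ∈ Jm m, c * e = c := by
  obtain ⟨s, rfl⟩ := Ideal.mem_span_singleton.1 hc
  have h1 : (X - C 1 : (ZMod 2)[X]) ∣ geomPoly m - 1 := by
    rw [dvd_iff_isRoot]
    obtain ⟨n, rfl⟩ := hm
    have h2 : (2 : ZMod 2) = 0 := rfl
    simp [geomPoly, eval_finsetSum, h2]
  obtain ⟨k, hk⟩ := h1
  have h3 : mk2 m (X - 1) * mk2 m (geomPoly m) = 0 := by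
    rw [← map_mul, mul_comm, geomPoly, geom_sum_mul]
    exact Ideal.Quotient.eq_zero_iff_mem.2 (Ideal.mem_span_singleton_self _)
  have h4 : mk2 m (geomPoly m) - 1 = mk2 m (X - 1) * mk2 m k := by
    rw [← map_mul, ← C_1, ← hk, map_sub, map_one]
  refine ⟨mk2 m (X - 1) * (- mk2 m k), Ideal.mul_mem_right _ _ (Ideal.mem_span_singleton_self _), ?_⟩
  linear_combination (mk2 m (X-1) * s) * h4 - s * h3

theorem ent_aux (α : ℝ) (h0 : 0 < α) (h1 : α < 1) :
    (1 + α / (1 - α)) = (2:ℝ) ^ Hent α * (α / (1 - α)) ^ α := by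
  have h2 : 0 < 1 - α := by linarith
  have e1 : 1 + α / (1 - α) = (1 - α)⁻¹ := by field_simp; ring
  have l2 : Real.log 2 ≠ 0 := by positivity
  rw [e1, Real.rpow_def_of_pos (by norm_num), Real.rpow_def_of_pos (by positivity), ← Real.exp_add,
    ← Real.exp_log (inv_pos.2 h2), Real.log_inv, Real.log_div h0.ne' h2.ne']
  congr 1
  unfold Hent Real.logb
  field_simp
  ring

theorem sum_cube (I : Type) [Fintype I] [DecidableEq I] (x : ℝ) :
    ∑ v : I → ZMod 2, x ^ (Finset.univ.filter (fun i => v i ≠ 0)).card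
      = (1 + x) ^ Fintype.card I := by
  have h := Finset.prod_univ_sum (fun _ : I => (Finset.univ : Finset (ZMod 2)))
    (fun _ (j : ZMod 2) => if j ≠ 0 then x else (1:ℝ))
  have h2 : ∑ j : ZMod 2, (if j ≠ 0 then x else (1:ℝ)) = 1 + x := by
    rw [show (Finset.univ : Finset (ZMod 2)) = {0, 1} from rfl]
    simp
  rw [h2] at h
  simp only [Finset.prod_const, Finset.card_univ, Fintype.piFinset_univ] at h
  rw [h]
  refine Finset.sum_congr rfl fun v _ => ?_
  rw [Finset.prod_ite]
  simp

theorem fiber_le {V I : Type} [AddCommGroup V] [Fintype V] [Module (ZMod 2) V]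
    [Fintype I] [DecidableEq I] (L : V →ₗ[ZMod 2] (I → ZMod 2)) (K : ℕ)
    (hK : Nat.card (LinearMap.ker L) = K) (F : (I → ZMod 2) → ℝ) (hF : ∀ v, 0 ≤ F v) :
    ∑ a : V, F (L a) ≤ K * ∑ v, F v := by
  classical
  rw [← Finset.sum_fiberwise Finset.univ (fun a => L a), Finset.mul_sum]
  refine Finset.sum_le_sum fun v _ => ?_
  have : ∑ a ∈ Finset.univ.filter (fun a => L a = v), F (L a)
      = ∑ a ∈ Finset.univ.filter (fun a => L a = v), F v :=
    Finset.sum_congr rfl fun a ha => by simp at ha; rw [ha]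
  rw [this, Finset.sum_const, nsmul_eq_mul]
  refine mul_le_mul_of_nonneg_right ?_ (hF v)
  rw [Nat.cast_le]
  rcases (Finset.univ.filter (fun a => L a = v)).eq_empty_or_nonempty with h | ⟨a0, ha0⟩
  · rw [h]; simp
  · simp at ha0
    rw [← hK, Nat.card_eq_fintype_card, ← Fintype.card_subtype]
    refine Fintype.card_le_of_injective
      (fun a => (⟨a.1 - a0, by simp [LinearMap.mem_ker, ha0, a.2]⟩ : LinearMap.ker L)) ?_
    intro a b hab
    simp only [Subtype.mk.injEq, sub_left_inj] at hab
    exact Subtype.ext hab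

theorem main_abs {V I T : Type} [AddCommGroup V] [Fintype V] [Module (ZMod 2) V]
    [Fintype I] [DecidableEq I] [Fintype T] [Nonempty T] (L : V →ₗ[ZMod 2] (I → ZMod 2)) (K : ℕ)
    (hK : Nat.card (LinearMap.ker L) = K) (σ : T → Equiv.Perm V) (W : V → ℕ)
    (hW : ∀ a, ∑ t, (Finset.univ.filter (fun i => L (σ t a) i ≠ 0)).card = Fintype.card I * W a)
    (α : ℝ) (h0 : 0 < α) (h1 : α < 1/2) :
    (Nat.card {p : V × V // ((W p.1 + W p.2 : ℕ) : ℝ) ≤ 2 * Fintype.card T * α} : ℝ) ≤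
      ((K:ℝ) * ((2:ℝ) ^ Hent α) ^ Fintype.card I) ^ 2 := by
  classical
  set x : ℝ := α / (1 - α) with hx
  have hxpos : 0 < x := div_pos h0 (by linarith)
  have hx1 : x ≤ 1 := by rw [hx, div_le_one (by linarith)]; linarith
  set d := Fintype.card I with hd
  set m := Fintype.card T with hm
  have hmpos : (0:ℝ) < m := by exact_mod_cast Fintype.card_pos
  let w : V → ℕ := fun a => (Finset.univ.filter (fun i => L a i ≠ 0)).card
  have hs : ∑ a, x ^ w a ≤ K * (1 + x) ^ d := by
    rw [← sum_cube]
    exact fiber_le L K hK (fun v => x ^ (Finset.univ.filter (fun i => v i ≠ 0)).card)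
      (fun v => by positivity)
  have hs0 : 0 ≤ ∑ a, x ^ w a := Finset.sum_nonneg fun _ _ => by positivity
  have key : ∀ p : V × V, ((W p.1 + W p.2 : ℕ) : ℝ) ≤ 2 * m * α →
      m * x ^ (2 * d * α) ≤ ∑ t, x ^ w (σ t p.1) * x ^ w (σ t p.2) := by
    intro p hp
    have J := convexOn_exp.map_sum_le (t := Finset.univ) (w := fun _ : T => (1 / m : ℝ))
      (p := fun t => Real.log x * (w (σ t p.1) + w (σ t p.2) : ℝ))
      (fun _ _ => by positivity) (by simp [← hm, hmpos.ne']) (fun _ _ => Set.mem_univ _)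
    have e1 : ∀ t, Real.exp (Real.log x * (w (σ t p.1) + w (σ t p.2) : ℝ))
        = x ^ w (σ t p.1) * x ^ w (σ t p.2) := by
      intro t
      rw [← Real.rpow_def_of_pos hxpos, Real.rpow_add hxpos, Real.rpow_natCast, Real.rpow_natCast]
    simp only [e1, smul_eq_mul, ← Finset.mul_sum] at J
    have e2 : (∑ t, ((w (σ t p.1) : ℝ) + w (σ t p.2))) = d * (W p.1 + W p.2 : ℕ) := by
      rw [Finset.sum_add_distrib]
      have := hW p.1
      have := hW p.2
      push_cast
      rw [mul_add]
      congr 1 <;> exact_mod_cast hW _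
    rw [e2] at J
    have : x ^ (2 * d * α) ≤ Real.exp (1 / m * (Real.log x * (d * (W p.1 + W p.2 : ℕ)))) := by
      rw [Real.rpow_def_of_pos hxpos, Real.exp_le_exp]
      have hl : Real.log x ≤ 0 := Real.log_nonpos hxpos.le hx1
      rw [show 1 / (m:ℝ) * (Real.log x * (d * (W p.1 + W p.2 : ℕ)))
        = Real.log x * (d * (W p.1 + W p.2 : ℕ) / m) by ring]
      refine mul_le_mul_of_nonpos_left ?_ hl
      rw [div_le_iff₀ hmpos]
      calc (d:ℝ) * (W p.1 + W p.2 : ℕ) ≤ d * (2 * m * α) := by gcongr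
        _ = _ := by ring
    have h3 := this.trans J
    calc m * x ^ (2 * d * α) ≤ m * (1 / m * ∑ t, x ^ w (σ t p.1) * x ^ w (σ t p.2)) := by gcongr
      _ = _ := by field_simp
  have tot : (Nat.card {p : V × V // ((W p.1 + W p.2 : ℕ) : ℝ) ≤ 2 * m * α} : ℝ) *
      (m * x ^ (2 * d * α)) ≤ m * (∑ a, x ^ w a) ^ 2 := by
    rw [Nat.card_eq_fintype_card, Fintype.card_subtype, ← nsmul_eq_mul, ← Finset.sum_const]
    calc _ ≤ ∑ p ∈ Finset.univ.filter (fun p : V × V => ((W p.1 + W p.2 : ℕ) : ℝ) ≤ 2 * m * α),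
          ∑ t, x ^ w (σ t p.1) * x ^ w (σ t p.2) :=
          Finset.sum_le_sum fun p hp => key p (Finset.mem_filter.1 hp).2
      _ ≤ ∑ p : V × V, ∑ t, x ^ w (σ t p.1) * x ^ w (σ t p.2) :=
          Finset.sum_le_sum_of_subset_of_nonneg (Finset.subset_univ _)
            fun _ _ _ => Finset.sum_nonneg fun _ _ => by positivity
      _ = ∑ t, ∑ p : V × V, x ^ w (σ t p.1) * x ^ w (σ t p.2) := Finset.sum_comm
      _ = ∑ t : T, (∑ a, x ^ w a) ^ 2 := by
          refine Finset.sum_congr rfl fun t _ => ?_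
          rw [Fintype.sum_prod_type, sq, ← Equiv.sum_comp (σ t) (fun a => x ^ w a), Finset.sum_mul_sum]
      _ = _ := by simp [hm]
  have e3 : (1 + x) = (2:ℝ) ^ Hent α * x ^ α := ent_aux α h0 (by linarith)
  have e4 : x ^ (2 * d * α) = ((x ^ α) ^ d) ^ 2 := by
    rw [← pow_mul, ← Real.rpow_natCast, ← Real.rpow_mul hxpos.le]
    congr 1; push_cast; ring
  have pos : 0 < m * x ^ (2 * d * α) := by positivity
  refine le_of_mul_le_mul_right (tot.trans ?_) pos
  calc m * (∑ a, x ^ w a) ^ 2 ≤ m * (K * (1 + x) ^ d) ^ 2 := by gcongr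
    _ = _ := by rw [e4, e3, mul_pow _ _ d]; ring

/-- For `c ∈ J_m` with `d_c = dim ⟨c⟩`, the number of pairs
`(a,b) ∈ J_m × J_m` with `1 ≤ wt_H(c·a) + 2·wt_H(c·b) ≤ 3mδ` is at most
`2^{2(m-1)} · 2^{-2 d_c + 2 d_c H(3δ/2)}`. -/
theorem statement8 (m : ℕ) (hm : Odd m) (hmpos : 0 < m)
    (δ : ℝ) (hδ0 : 0 < δ) (hδ1 : δ < 1/3) (hδ2 : Hent (3*δ/2) < 1/2)
    (c : R2 m) (hc : c ∈ Jm m) (dc : ℕ)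
    (hdc : dc = Module.finrank (ZMod 2) (Ideal.span {c} : Ideal (R2 m))) :
    (Nat.card {p : R2 m × R2 m // p.1 ∈ Jm m ∧ p.2 ∈ Jm m ∧
        1 ≤ wt2 m (c * p.1) + 2 * wt2 m (c * p.2) ∧
        ((wt2 m (c * p.1) + 2 * wt2 m (c * p.2) : ℕ) : ℝ) ≤ 3 * m * δ} : ℝ)
      ≤ (2 : ℝ) ^ (2 * ((m : ℝ) - 1)) *
        (2 : ℝ) ^ (-2 * (dc : ℝ) + 2 * (dc : ℝ) * Hent (3*δ/2)) := by
  have hne : NeZero m := ⟨hmpos.ne'⟩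
  have hfin := finite_R2 m hmpos
  have hfinite : Finite (R2 m) := Module.finite_of_finite (ZMod 2)
  have hft : Fintype (Jm m) := Fintype.ofFinite _
  have hfC : Module.Finite (ZMod 2) (Ideal.span {c} : Ideal (R2 m)) := Module.Finite.of_finite
  obtain ⟨κ, hκ, ι, hcard, hinj⟩ := info_set (C := (Ideal.span {c} : Ideal (R2 m)))
    (fun i => (coefL m hmpos i).comp
      ((Submodule.subtype (Ideal.span {c} : Ideal (R2 m))).restrictScalars (ZMod 2)))
    (fun f hf => Subtype.ext (coefL_sep m hmpos f.1 hf))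
  classical
  let G : (Ideal.span {c} : Ideal (R2 m)) →ₗ[ZMod 2] (κ → ZMod 2) :=
    LinearMap.pi (fun k => (coefL m hmpos (ι k)).comp
      ((Submodule.subtype (Ideal.span {c} : Ideal (R2 m))).restrictScalars (ZMod 2)))
  have hG : LinearMap.ker G = ⊥ := by
    rw [LinearMap.ker_eq_bot']
    intro f hf
    exact hinj f (fun k => congrFun hf k)
  let g : Jm m →ₗ[ZMod 2] (Ideal.span {c} : Ideal (R2 m)) :=
    { toFun := fun a => ⟨c * a.1, Ideal.mul_mem_right _ _ (Ideal.mem_span_singleton_self _)⟩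
      map_add' := fun a b => Subtype.ext (mul_add c a.1 b.1)
      map_smul' := fun r a => Subtype.ext (mul_smul_comm r c a.1) }
  have hg : Function.Surjective g := by
    rintro ⟨f, hf⟩
    obtain ⟨s, rfl⟩ := Ideal.mem_span_singleton.1 hf
    obtain ⟨e, he, hce⟩ := mem_Jm_factor m hm c hc
    refine ⟨⟨e * s, Ideal.mul_mem_right _ _ he⟩, Subtype.ext ?_⟩
    change c * (e * s) = c * s
    rw [← mul_assoc, hce]
  have hu : ∀ t : ZMod m, mk2 m X ^ t.val * mk2 m X ^ (m - t.val) = 1 := by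
    intro t
    rw [← pow_add, Nat.add_sub_cancel' (ZMod.val_lt t).le, X_pow_m]
  let σ : ZMod m → Equiv.Perm (Jm m) := fun t =>
    { toFun := fun a => ⟨mk2 m X ^ t.val * a.1, Ideal.mul_mem_left _ _ a.2⟩
      invFun := fun a => ⟨mk2 m X ^ (m - t.val) * a.1, Ideal.mul_mem_left _ _ a.2⟩
      left_inv := fun a => Subtype.ext (by
        change mk2 m X ^ (m - t.val) * (mk2 m X ^ t.val * a.1) = a.1
        linear_combination a.1 * hu t)
      right_inv := fun a => Subtype.ext (by
        change mk2 m X ^ t.val * (mk2 m X ^ (m - t.val) * a.1) = a.1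
        linear_combination a.1 * hu t) }
  have hW : ∀ a : Jm m, ∑ t, (Finset.univ.filter (fun i => (G.comp g) (σ t a) i ≠ 0)).card
      = Fintype.card κ * wt2 m (c * a.1) := by
    intro a
    have e : ∀ t i, (G.comp g) (σ t a) i = coefL m hmpos (ι i - t) (c * a.1) := by
      intro t i
      change coefL m hmpos (ι i) (c * (mk2 m X ^ t.val * a.1)) = _
      rw [mul_left_comm, coefL_shift_pow]
      simp
    simp only [e, Finset.card_filter]
    rw [Finset.sum_comm]
    have e2 : ∀ k : κ, ∑ t : ZMod m, (if coefL m hmpos (ι k - t) (c * a.1) ≠ 0 then 1 else 0)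
        = wt2 m (c * a.1) := by
      intro k
      rw [wt2_eq m hmpos, Finset.card_filter]
      exact Equiv.sum_comp (Equiv.subLeft (ι k))
        (fun t => if coefL m hmpos t (c * a.1) ≠ 0 then 1 else 0)
    rw [Finset.sum_congr rfl (fun k _ => e2 k)]
    simp
  have main := main_abs (G.comp g) _ rfl σ (fun a => wt2 m (c * a.1)) hW (3 * δ / 2)
    (by linarith) (by linarith)
  rw [ZMod.card, hcard, ← hdc, LinearMap.ker_comp_of_ker_eq_bot _ hG] at main
  -- size of the kernel
  have hker : Module.finrank (ZMod 2) (LinearMap.ker g) + dc + 1 ≤ m := by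
    have h1 := LinearMap.finrank_range_add_finrank_ker g
    rw [LinearMap.range_eq_top.2 hg, finrank_top, ← hdc] at h1
    have h2 : Module.finrank (ZMod 2) (Jm m) < m := by
      have h3 := Submodule.finrank_lt (K := ZMod 2) (V := R2 m)
        (s := (Jm m).restrictScalars (ZMod 2))
        (by
          intro h
          exact Jm_ne_top m ((Submodule.restrictScalars_eq_top_iff _ _ _).1 h))
      rw [finrank_R2 m hmpos] at h3
      exact h3
    omega
  have hKle : (Nat.card (LinearMap.ker g) : ℝ) ≤ (2:ℝ) ^ ((m:ℝ) - 1 - dc) := by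
    rw [Module.natCard_eq_pow_finrank (K := ZMod 2), Nat.card_zmod]
    push_cast
    rw [← Real.rpow_natCast]
    apply Real.rpow_le_rpow_of_exponent_le (by norm_num)
    have : ((Module.finrank (ZMod 2) (LinearMap.ker g) + dc + 1 : ℕ) : ℝ) ≤ m := by
      exact_mod_cast hker
    push_cast at this
    linarith
  -- comparison of the counted sets
  have hcmp : Nat.card {p : R2 m × R2 m // p.1 ∈ Jm m ∧ p.2 ∈ Jm m ∧
        1 ≤ wt2 m (c * p.1) + 2 * wt2 m (c * p.2) ∧
        ((wt2 m (c * p.1) + 2 * wt2 m (c * p.2) : ℕ) : ℝ) ≤ 3 * m * δ} ≤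
      Nat.card {p : Jm m × Jm m //
        ((wt2 m (c * p.1.1) + wt2 m (c * p.2.1) : ℕ) : ℝ) ≤ 2 * m * (3 * δ / 2)} := by
    refine Nat.card_le_card_of_injective
      (fun p => ⟨(⟨p.1.1, p.2.1⟩, ⟨p.1.2, p.2.2.1⟩), ?_⟩) ?_
    · have h1 := p.2.2.2.2
      push_cast at h1 ⊢
      have h2 : (0:ℝ) ≤ wt2 m (c * p.1.2) := Nat.cast_nonneg _
      linarith
    · intro p q hpq
      simp only [Subtype.mk.injEq, Prod.mk.injEq] at hpq
      exact Subtype.ext (Prod.ext hpq.1 hpq.2)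
  have hcmp' := (Nat.cast_le (α := ℝ)).2 hcmp
  refine (hcmp'.trans main).trans ?_
  calc _ ≤ ((2:ℝ) ^ ((m:ℝ) - 1 - dc) * ((2:ℝ) ^ Hent (3*δ/2)) ^ dc) ^ 2 := by gcongr
    _ = _ := by
      rw [← Real.rpow_natCast _ dc, ← Real.rpow_mul (by norm_num), ← Real.rpow_add (by norm_num),
        ← Real.rpow_add (by norm_num), ← Real.rpow_natCast _ 2, ← Real.rpow_mul (by norm_num)]
      congr 1
      push_cast
      ring

end
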